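/- Let X be a set of 11 distinct points of P^2 with generic Hilbert function. If H_{2X}(6) = 26, then H_{2X}(7) ≥ 31; equivalently, if dim_k (I_{2X})_6 = 2 then dim_k (I_{2X})_7 ≤ 5. -/

import Mathlib

open MvPolynomial

/-- The vanishing (prime) ideal of a point of ℙ²: the ideal generated by the
linear forms vanishing at the point. -/
noncomputable def pointIdeal (k : Type) [Field k] (P : Projectivization k (Fin 3 → k)) :
    Ideal (MvPolynomial (Fin 3) k) :=
  Ideal.span {f : MvPolynomial (Fin 3) k | f.IsHomogeneous 1 ∧ eval P.rep f = 0}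

/-- The Hilbert function of R/I: H(t) = dim_k R_t − dim_k I_t. -/
noncomputable def hilbertFunction (k : Type) [Field k]
    (I : Ideal (MvPolynomial (Fin 3) k)) (t : ℕ) : ℕ :=
  Module.finrank k ↥(homogeneousSubmodule (Fin 3) k t) -
    Module.finrank k ↥(Submodule.restrictScalars k I ⊓ homogeneousSubmodule (Fin 3) k t)

/-- The defining ideal `I_X` of a finite set of points. -/
noncomputable def idealOfPoints (k : Type) [Field k] {s : ℕ}
    (P : Fin s → Projectivization k (Fin 3 → k)) : Ideal (MvPolynomial (Fin 3) k) :=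
  ⨅ i, pointIdeal k (P i)

/-- The defining ideal `I_{2X}` of the double point scheme supported on a finite set of points. -/
noncomputable def doubleIdealOfPoints (k : Type) [Field k] {s : ℕ}
    (P : Fin s → Projectivization k (Fin 3 → k)) : Ideal (MvPolynomial (Fin 3) k) :=
  ⨅ i, (pointIdeal k (P i)) ^ 2

/-- `X` has generic Hilbert function: `H_X(t) = min {s, binom(t+2,2)}` for all `t`. -/
def HasGenericHilbertFunction (k : Type) [Field k] {s : ℕ}
    (P : Fin s → Projectivization k (Fin 3 → k)) : Prop :=
  ∀ t : ℕ, hilbertFunction k (idealOfPoints k P) t = min s (Nat.choose (t + 2) 2)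

theorem aeval_mul_const_of_isHomogeneous {σ A S : Type*} [CommSemiring A] [CommSemiring S]
    [Algebra A S] {f : MvPolynomial σ A} {n : ℕ} (hf : f.IsHomogeneous n) (g : σ → S) (t : S) :
    aeval (fun j => g j * t) f = aeval g f * t ^ n := by
  simp only [aeval_def, eval₂_eq, Finset.sum_mul, mul_assoc]
  refine Finset.sum_congr rfl fun d hd => ?_
  rw [hf.degree_eq_sum_deg_support hd]
  simp [mul_pow, Finset.prod_mul_distrib, Finset.prod_pow_eq_pow_sum]

theorem exists_isHomogeneous_of_mul {σ A : Type*} [CommRing A] [IsDomain A]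
    {f g : MvPolynomial σ A} {n : ℕ} (h : (f * g).IsHomogeneous n) (h0 : f * g ≠ 0) :
    ∃ i, f.IsHomogeneous i := by
  obtain ⟨hf, hg⟩ := mul_ne_zero_iff.1 h0
  let θ : MvPolynomial σ A →ₐ[A] Polynomial (MvPolynomial σ A) :=
    aeval fun j => Polynomial.C (X j) * Polynomial.X
  have hC : ∀ q : MvPolynomial σ A,
      aeval (fun j => (Polynomial.C (X j : MvPolynomial σ A))) q = Polynomial.C q := by
    intro q
    induction q using MvPolynomial.induction_on with
    | C a => simp [Polynomial.algebraMap_apply, MvPolynomial.algebraMap_eq]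
    | add p q hp hq => simp [hp, hq]
    | mul_X p i hp => simp [hp]
  have hθ : ∀ {q : MvPolynomial σ A} {m : ℕ}, q.IsHomogeneous m →
      θ q = Polynomial.C q * Polynomial.X ^ m := by
    intro q m hq
    rw [← hC]
    exact aeval_mul_const_of_isHomogeneous hq _ _
  have hcoeff : ∀ (q : MvPolynomial σ A) (m : ℕ), (θ q).coeff m = homogeneousComponent m q := by
    intro q m
    conv_lhs => rw [← sum_homogeneousComponent q]
    rw [map_sum, Polynomial.finsetSum_coeff]
    simp_rw [hθ (homogeneousComponent_isHomogeneous _ q), Polynomial.coeff_C_mul_X_pow]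
    rw [Finset.sum_ite_eq]
    split_ifs with hm
    · rfl
    · rw [homogeneousComponent_eq_zero]
      simpa [Nat.lt_succ_iff] using hm
  have hne : ∀ q : MvPolynomial σ A, q ≠ 0 → θ q ≠ 0 := by
    intro q hq h
    apply hq
    rw [← sum_homogeneousComponent q]
    exact Finset.sum_eq_zero fun m _ => by rw [← hcoeff, h, Polynomial.coeff_zero]
  have hmul : θ f * θ g = Polynomial.C (f * g) * Polynomial.X ^ n := by
    rw [← map_mul, hθ h]
  have hd : (θ f).natDegree + (θ g).natDegree = n := by
    rw [← Polynomial.natDegree_mul (hne f hf) (hne g hg), hmul,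
      Polynomial.natDegree_C_mul_X_pow _ _ h0]
  have ht : (θ f).natTrailingDegree + (θ g).natTrailingDegree = n := by
    rw [← Polynomial.natTrailingDegree_mul (hne f hf) (hne g hg), hmul,
      Polynomial.C_mul_X_pow_eq_monomial, Polynomial.natTrailingDegree_monomial h0]
  have h1 := (θ f).natTrailingDegree_le_natDegree
  have h2 := (θ g).natTrailingDegree_le_natDegree
  refine ⟨(θ f).natDegree, ?_⟩
  suffices key : (∑ i ∈ Finset.range (f.totalDegree + 1), homogeneousComponent i f).IsHomogeneous
      (θ f).natDegree by rwa [sum_homogeneousComponent] at key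
  refine IsHomogeneous.sum _ _ _ fun m _ => ?_
  rcases lt_trichotomy m (θ f).natDegree with hm | rfl | hm
  · rw [← hcoeff, Polynomial.coeff_eq_zero_of_lt_natTrailingDegree (by omega)]
    exact isHomogeneous_zero σ A _
  · exact homogeneousComponent_isHomogeneous _ f
  · rw [← hcoeff, Polynomial.coeff_eq_zero_of_natDegree_lt hm]
    exact isHomogeneous_zero σ A _

theorem finrank_homogeneousSubmodule_fin_three (k : Type*) [Field k] (n : ℕ) :
    Module.finrank k (homogeneousSubmodule (Fin 3) k n) = (n + 2).choose 2 := by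
  have e : {d : Fin 3 →₀ ℕ | d.degree = n} ≃ Finset.finsuppAntidiag (Finset.univ : Finset (Fin 3)) n :=
    Equiv.subtypeEquivRight fun d => by
      simp [Finset.mem_finsuppAntidiag, Finsupp.degree_eq_sum]
  have : Fintype {d : Fin 3 →₀ ℕ | d.degree = n} := Fintype.ofEquiv _ e.symm
  rw [homogeneousSubmodule_eq_finsupp_supported]
  have : Module.finrank k ({d : Fin 3 →₀ ℕ | d.degree = n} →₀ k) = (n + 2).choose 2 := by
    rw [Module.finrank_finsupp_self, Fintype.card_congr e, Fintype.card_coe,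
      Finset.card_finsuppAntidiag_nat_eq_choose]
    simp only [Finset.card_univ, Fintype.card_fin]
    rw [show 3 + n - 1 = n + 2 by omega]
    exact Nat.choose_symm_add
  rw [← this]
  exact (AddMonoidAlgebra.supportedEquivFinsupp _).finrank_eq

instance finite_homogeneousSubmodule (k : Type*) [Field k] (n : ℕ) :
    Module.Finite k (homogeneousSubmodule (Fin 3) k n) :=
  Module.Finite.iff_fg.2 (homogeneousSubmodule_fg (Fin 3) k n)

/-- Restriction of a polynomial to the line through `p` with direction `v`. -/
noncomputable def restrictLine {k : Type*} [CommRing k] (p v : Fin 3 → k) :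
    MvPolynomial (Fin 3) k →ₐ[k] Polynomial k :=
  aeval fun j => Polynomial.C (p j) + Polynomial.C (v j) * Polynomial.X

/-- `f` vanishes to order at least `m` at `p`. -/
def VanishesToOrder {k : Type*} [CommRing k] (m : ℕ) (p : Fin 3 → k)
    (f : MvPolynomial (Fin 3) k) : Prop :=
  ∀ v, Polynomial.X ^ m ∣ restrictLine p v f

/-- The linear form with coefficient vector `w`. -/
noncomputable def linForm {k : Type*} [CommRing k] (w : Fin 3 → k) : MvPolynomial (Fin 3) k :=
  ∑ j, C (w j) * X j

/-- The derivative of `f` in the direction `v`. -/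
noncomputable def dirDeriv {k : Type*} [CommRing k] (v : Fin 3 → k) (f : MvPolynomial (Fin 3) k) :
    MvPolynomial (Fin 3) k :=
  ∑ j, C (v j) * pderiv j f

section

variable {k : Type*} [Field k] {p v : Fin 3 → k} {f g : MvPolynomial (Fin 3) k} {m n : ℕ}

theorem coeff_zero_restrictLine (p v : Fin 3 → k) (f : MvPolynomial (Fin 3) k) :
    (restrictLine p v f).coeff 0 = eval p f := by
  rw [Polynomial.coeff_zero_eq_eval_zero, restrictLine]
  induction f using MvPolynomial.induction_on with
  | C a => simp
  | add p q hp hq => simp [hp, hq]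
  | mul_X p i hp => simp [hp]

theorem VanishesToOrder.mono (h : VanishesToOrder n p f) (hmn : m ≤ n) : VanishesToOrder m p f :=
  fun v => (pow_dvd_pow _ hmn).trans (h v)

theorem vanishesToOrder_zero (p : Fin 3 → k) (f : MvPolynomial (Fin 3) k) :
    VanishesToOrder 0 p f := fun v => by simp

theorem vanishesToOrder_one : VanishesToOrder 1 p f ↔ eval p f = 0 := by
  simp [VanishesToOrder, Polynomial.X_dvd_iff, coeff_zero_restrictLine]

theorem VanishesToOrder.mul (hf : VanishesToOrder m p f) (hg : VanishesToOrder n p g) :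
    VanishesToOrder (m + n) p (f * g) := fun v => by
  rw [map_mul, pow_add]
  exact mul_dvd_mul (hf v) (hg v)

theorem VanishesToOrder.mul_right (hg : VanishesToOrder n p g) (f : MvPolynomial (Fin 3) k) :
    VanishesToOrder n p (g * f) := by
  simpa using hg.mul (vanishesToOrder_zero p f)

theorem VanishesToOrder.sub (hf : VanishesToOrder n p f) (hg : VanishesToOrder n p g) :
    VanishesToOrder n p (f - g) := fun v => by
  rw [map_sub]
  exact dvd_sub (hf v) (hg v)

theorem VanishesToOrder.sum {ι : Type*} (s : Finset ι) {φ : ι → MvPolynomial (Fin 3) k}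
    (h : ∀ i ∈ s, VanishesToOrder n p (φ i)) : VanishesToOrder n p (∑ i ∈ s, φ i) := fun v => by
  rw [map_sum]
  exact Finset.dvd_sum fun i hi => h i hi v

theorem VanishesToOrder.of_mul (h : VanishesToOrder n p (f * g)) (hf : eval p f ≠ 0) :
    VanishesToOrder n p g := fun v => by
  have h1 := h v
  rw [map_mul] at h1
  refine IsCoprime.dvd_of_dvd_mul_left (IsCoprime.pow_left ?_) h1
  rw [(Polynomial.irreducible_X).coprime_iff_not_dvd, Polynomial.X_dvd_iff,
    coeff_zero_restrictLine]
  exact hf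

theorem VanishesToOrder.eval_eq_zero_of_mul (h : VanishesToOrder 2 p (f * g))
    (hf : ¬ VanishesToOrder 2 p f) : eval p g = 0 := by
  by_contra hg
  exact hf (VanishesToOrder.of_mul (by rwa [mul_comm]) hg)

theorem restrictLine_linForm (p v w : Fin 3 → k) :
    restrictLine p v (linForm w) =
      Polynomial.C (∑ j, w j * p j) + Polynomial.C (∑ j, w j * v j) * Polynomial.X := by
  simp only [restrictLine, linForm, Fin.sum_univ_three, map_add, map_mul, aeval_X, aeval_C,
    Polynomial.algebraMap_apply, Algebra.algebraMap_self, RingHom.id_apply]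
  ring

theorem isHomogeneous_linForm (w : Fin 3 → k) : (linForm w).IsHomogeneous 1 :=
  IsHomogeneous.sum _ _ _ fun _ _ => isHomogeneous_C_mul_X _ _

theorem eval_linForm (p w : Fin 3 → k) : eval p (linForm w) = ∑ j, w j * p j := by
  simp [linForm]

/-- First order Taylor expansion modulo the square of an ideal. -/
theorem aeval_add_sub_taylor_mem {S : Type*} [CommRing S] [Algebra k S] (I : Ideal S)
    (a u : Fin 3 → S) (hu : ∀ j, u j ∈ I) (f : MvPolynomial (Fin 3) k) :
    aeval (fun j => a j + u j) f - (aeval a f + ∑ j, u j * aeval a (pderiv j f)) ∈ I ^ 2 := by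
  induction f using MvPolynomial.induction_on with
  | C c => simp
  | add p q hp hq =>
    convert Ideal.add_mem _ hp hq using 1
    simp only [map_add, mul_add, Finset.sum_add_distrib]
    ring
  | mul_X q i hq =>
    have hs : ∑ j, u j * aeval a (pderiv j (q * X i)) =
        u i * aeval a q + (∑ j, u j * aeval a (pderiv j q)) * a i := by
      simp only [Derivation.leibniz, pderiv_X, map_add, smul_eq_mul, map_mul, aeval_X, mul_add,
        Finset.sum_add_distrib, Finset.sum_mul]
      congr 1
      · rw [Finset.sum_eq_single i]
        · simp
        · intro j _ hj
          simp [hj.symm]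
        · simp
      · exact Finset.sum_congr rfl fun j _ => by ring
    have hT : ∑ j, u j * aeval a (pderiv j q) ∈ I :=
      Ideal.sum_mem _ fun j _ => Ideal.mul_mem_right _ _ (hu j)
    have h2 : (∑ j, u j * aeval a (pderiv j q)) * u i ∈ I ^ 2 := by
      rw [pow_two]
      exact Ideal.mul_mem_mul hT (hu i)
    rw [hs]
    simp only [map_mul, aeval_X]
    convert Ideal.add_mem _ (Ideal.mul_mem_right (a i + u i) _ hq) h2 using 1
    ring

theorem vanishesToOrder_two :
    VanishesToOrder 2 p f ↔ eval p f = 0 ∧ ∀ j, eval p (pderiv j f) = 0 := by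
  have hC : ∀ q : MvPolynomial (Fin 3) k,
      aeval (fun j => Polynomial.C (p j)) q = Polynomial.C (eval p q) := by
    intro q
    induction q using MvPolynomial.induction_on with
    | C a => simp
    | add p q hp hq => simp [hp, hq]
    | mul_X p i hp => simp [hp]
  have key : ∀ v, Polynomial.X ^ 2 ∣ restrictLine p v f - (Polynomial.C (eval p f) +
      Polynomial.C (∑ j, v j * eval p (pderiv j f)) * Polynomial.X) := by
    intro v
    have h := aeval_add_sub_taylor_mem (Ideal.span {(Polynomial.X : Polynomial k)})
      (fun j => Polynomial.C (p j)) (fun j => Polynomial.C (v j) * Polynomial.X)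
      (fun j => Ideal.mul_mem_left _ _ (Ideal.mem_span_singleton_self _)) f
    rw [Ideal.span_singleton_pow, Ideal.mem_span_singleton] at h
    convert h using 3
    · rfl
    · exact (hC f).symm
    · simp only [hC, map_sum, Finset.sum_mul, map_mul]
      exact Finset.sum_congr rfl fun j _ => by ring
  constructor
  · intro h
    have h0 : eval p f = 0 := vanishesToOrder_one.1 (h.mono one_le_two)
    refine ⟨h0, fun j => ?_⟩
    have h1 := (dvd_sub_right (h (Pi.single j 1))).1 (key (Pi.single j 1))
    rw [h0, Polynomial.X_pow_dvd_iff] at h1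
    have := h1 1 one_lt_two
    simpa [Pi.single_apply] using this
  · rintro ⟨h0, h1⟩ v
    simpa [h0, h1] using key v

theorem VanishesToOrder.dirDeriv (h : VanishesToOrder 2 p f) (v : Fin 3 → k) :
    VanishesToOrder 1 p (dirDeriv v f) := by
  rw [vanishesToOrder_one]
  simp [_root_.dirDeriv, (vanishesToOrder_two.1 h).2]

end

section

variable {k : Type*} [Field k]

/-- A point of the projective plane together with a dual affine frame. -/
theorem exists_dual_frame {p : Fin 3 → k} (hp : p ≠ 0) :
    ∃ l₀ l₁ l₂ u v : Fin 3 → k,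
      (∑ j, l₀ j * p j = 1 ∧ ∑ j, l₁ j * p j = 0 ∧ ∑ j, l₂ j * p j = 0) ∧
      (∑ j, l₀ j * u j = 0 ∧ ∑ j, l₁ j * u j = 1 ∧ ∑ j, l₂ j * u j = 0) ∧
      (∑ j, l₀ j * v j = 0 ∧ ∑ j, l₁ j * v j = 0 ∧ ∑ j, l₂ j * v j = 1) := by
  obtain ⟨c, hc⟩ := Function.ne_iff.1 hp
  simp only [Pi.zero_apply] at hc
  simp only [Fin.sum_univ_three]
  fin_cases c
  · refine ⟨![(p 0)⁻¹, 0, 0], ![-p 1 / p 0, 1, 0], ![-p 2 / p 0, 0, 1], ![0, 1, 0], ![0, 0, 1], ?_⟩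
    simp at hc ⊢
    field_simp
    simp
  · refine ⟨![0, (p 1)⁻¹, 0], ![1, -p 0 / p 1, 0], ![0, -p 2 / p 1, 1], ![1, 0, 0], ![0, 0, 1], ?_⟩
    simp at hc ⊢
    field_simp
    simp
  · refine ⟨![0, 0, (p 2)⁻¹], ![1, 0, -p 0 / p 2], ![0, 1, -p 1 / p 2], ![1, 0, 0], ![0, 1, 0], ?_⟩
    simp at hc ⊢
    field_simp
    simp

/-- Forms of degree `n ≥ 4` with prescribed jets of order at most two at a point. -/
theorem exists_jets {p : Fin 3 → k} (hp : p ≠ 0) {n : ℕ} (hn : 4 ≤ n) :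
    ∃ Θ : (Fin 3 × Fin 3 → k) →ₗ[k] homogeneousSubmodule (Fin 3) k n,
      ∀ m ≤ 3, ∀ c, VanishesToOrder m p (Θ c : MvPolynomial (Fin 3) k) →
        ∀ x : Fin 3 × Fin 3, (x.1 : ℕ) + x.2 < m → c x = 0 := by
  obtain ⟨l₀, l₁, l₂, u, v, ⟨hp0, hp1, hp2⟩, ⟨hu0, hu1, hu2⟩, ⟨hv0, hv1, hv2⟩⟩ :=
    exists_dual_frame hp
  let mon : Fin 3 × Fin 3 → homogeneousSubmodule (Fin 3) k n := fun x =>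
    ⟨linForm l₀ ^ (n - x.1 - x.2) * linForm l₁ ^ (x.1 : ℕ) * linForm l₂ ^ (x.2 : ℕ), by
      have h := (((isHomogeneous_linForm l₀).pow (n - x.1 - x.2)).mul
        ((isHomogeneous_linForm l₁).pow x.1)).mul ((isHomogeneous_linForm l₂).pow x.2)
      have hd : 1 * (n - (x.1 : ℕ) - x.2) + 1 * x.1 + 1 * x.2 = n := by
        have := x.1.2
        have := x.2.2
        omega
      rwa [hd] at h⟩
  refine ⟨Fintype.linearCombination k mon, fun m hm c hc => ?_⟩
  have hline : ∀ α β : k, restrictLine p (fun j => α * u j + β * v j)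
      (Fintype.linearCombination k mon c : homogeneousSubmodule (Fin 3) k n) =
      ∑ i : Fin 3, ∑ j : Fin 3, Polynomial.C (c (i, j) * α ^ (i : ℕ) * β ^ (j : ℕ)) *
        Polynomial.X ^ ((i : ℕ) + j) := by
    intro α β
    have hl : ∀ l : Fin 3 → k, ∑ j, l j * (α * u j + β * v j) =
        α * ∑ j, l j * u j + β * ∑ j, l j * v j := by
      intro l
      rw [Finset.mul_sum, Finset.mul_sum, ← Finset.sum_add_distrib]
      exact Finset.sum_congr rfl fun j _ => by ring
    rw [Fintype.linearCombination_apply, Submodule.coe_sum, map_sum, Fintype.sum_prod_type]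
    refine Finset.sum_congr rfl fun i _ => Finset.sum_congr rfl fun j _ => ?_
    simp only [mon, Submodule.coe_smul, map_smul, map_mul, map_pow, restrictLine_linForm, hl,
      hp0, hp1, hp2, hu0, hu1, hu2, hv0, hv1, hv2, Polynomial.smul_eq_C_mul]
    simp
    ring
  have hco : ∀ α β : k, ∀ i < m, (∑ i : Fin 3, ∑ j : Fin 3,
      Polynomial.C (c (i, j) * α ^ (i : ℕ) * β ^ (j : ℕ)) *
        Polynomial.X ^ ((i : ℕ) + j)).coeff i = 0 := by
    intro α β
    rw [← hline]
    exact Polynomial.X_pow_dvd_iff.1 (hc _)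
  simp only [Fin.sum_univ_three, Polynomial.coeff_add, Polynomial.coeff_C_mul_X_pow] at hco
  have h0 : 0 < m → c (0, 0) = 0 := fun h => by
    simpa using hco 0 0 0 h
  have h10 : 1 < m → c (1, 0) = 0 := fun h => by
    simpa using hco 1 0 1 h
  have h01 : 1 < m → c (0, 1) = 0 := fun h => by
    simpa using hco 0 1 1 h
  have h20 : 2 < m → c (2, 0) = 0 := fun h => by
    simpa using hco 1 0 2 h
  have h02 : 2 < m → c (0, 2) = 0 := fun h => by
    simpa using hco 0 1 2 h
  have h11 : 2 < m → c (1, 1) = 0 := fun h => by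
    simpa [h20 h, h02 h] using hco 1 1 2 h
  rintro ⟨a, b⟩ hx
  fin_cases a <;> fin_cases b <;> simp at hx ⊢
  · exact h0 hx
  · exact h01 hx
  · exact h02 hx
  · exact h10 hx
  · exact h11 hx
  · omega
  · exact h20 hx
  · omega
  · omega

/-- Two distinct points are separated by linear forms. -/
def Separated {ι : Type*} (p : ι → Fin 3 → k) : Prop :=
  ∀ i j, i ≠ j → ∃ w, eval (p j) (linForm w) = 0 ∧ eval (p i) (linForm w) ≠ 0

theorem exists_separator {ι : Type*} [Fintype ι] [DecidableEq ι] {p : ι → Fin 3 → k}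
    (hsep : Separated p) (i : ι) :
    ∃ h : MvPolynomial (Fin 3) k, h.IsHomogeneous (3 * (Fintype.card ι - 1)) ∧
      eval (p i) h ≠ 0 ∧ ∀ j, j ≠ i → VanishesToOrder 3 (p j) h := by
  choose! w hw using hsep i
  refine ⟨∏ j ∈ Finset.univ.erase i, linForm (w j) ^ 3, ?_, ?_, ?_⟩
  · have h := IsHomogeneous.prod (Finset.univ.erase i) (fun j => linForm (w j) ^ 3) (fun _ => 3)
      fun j _ => by simpa using (isHomogeneous_linForm (w j)).pow 3
    simpa [Finset.card_erase_of_mem, mul_comm] using h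
  · rw [map_prod, Finset.prod_ne_zero_iff]
    intro j hj
    rw [map_pow]
    exact pow_ne_zero _ (hw j (Finset.ne_of_mem_erase hj).symm).2
  · intro j hj
    rw [← Finset.mul_prod_erase _ _ (Finset.mem_erase.2 ⟨hj, Finset.mem_univ j⟩)]
    refine VanishesToOrder.mul_right ?_ _
    have h1 := vanishesToOrder_one.2 (hw j hj.symm).1
    simpa [pow_succ] using (h1.mul h1).mul h1

/-- Multiplication by a form, as a map between spaces of forms. -/
noncomputable def mulForm {f : MvPolynomial (Fin 3) k} {d a t : ℕ} (hf : f.IsHomogeneous d)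
    (h : d + a = t) :
    homogeneousSubmodule (Fin 3) k a →ₗ[k] homogeneousSubmodule (Fin 3) k t :=
  (LinearMap.mulLeft k f).restrict fun _ hg => h ▸ hf.mul hg

@[simp]
theorem coe_mulForm {f : MvPolynomial (Fin 3) k} {d a t : ℕ} (hf : f.IsHomogeneous d)
    (h : d + a = t) (g : homogeneousSubmodule (Fin 3) k a) :
    (mulForm hf h g : MvPolynomial (Fin 3) k) = f * g := rfl

/-- Evaluation of forms at a family of points. -/
noncomputable def evalForms {κ : Type*} (q : κ → Fin 3 → k) (a : ℕ) :
    homogeneousSubmodule (Fin 3) k a →ₗ[k] (κ → k) :=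
  LinearMap.pi fun i => (aeval (q i)).toLinearMap ∘ₗ Submodule.subtype _

@[simp]
theorem evalForms_apply {κ : Type*} (q : κ → Fin 3 → k) (a : ℕ)
    (g : homogeneousSubmodule (Fin 3) k a) (i : κ) :
    evalForms q a g i = eval (q i) (g : MvPolynomial (Fin 3) k) := by
  simp [evalForms, aeval_eq_eval]

end

theorem two_mul_choose_add_two (n : ℕ) : 2 * (n + 2).choose 2 = (n + 2) * (n + 1) := by
  have := Nat.add_one_mul_choose_eq (n + 1) 1
  simp only [Nat.choose_one_right] at this
  linarith

theorem choose_two_second_difference (d e r : ℕ) :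
    (d + (e + r) + 2).choose 2 + (r + 2).choose 2 + d * e =
      (e + r + 2).choose 2 + (d + r + 2).choose 2 + 2 * (d * e) := by
  have h1 := two_mul_choose_add_two (d + (e + r))
  have h2 := two_mul_choose_add_two r
  have h3 := two_mul_choose_add_two (e + r)
  have h4 := two_mul_choose_add_two (d + r)
  nlinarith

section

variable {k : Type*} [Field k]

/-- Bézout's inequality for coprime forms, weighted by multiplicities at most two. -/
theorem sum_mul_le_of_isRelPrime {ι : Type*} [Fintype ι] [DecidableEq ι] {p : ι → Fin 3 → k}
    (hp : ∀ i, p i ≠ 0) (hsep : Separated p) {F G : MvPolynomial (Fin 3) k} {d e : ℕ}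
    (hF : F.IsHomogeneous d) (hG : G.IsHomogeneous e) (hG0 : G ≠ 0)
    (hFG : IsRelPrime F G) {μ ν : ι → ℕ} (hμ : ∀ i, μ i ≤ 2) (hν : ∀ i, ν i ≤ 2)
    (hμF : ∀ i, VanishesToOrder (μ i) (p i) F) (hνG : ∀ i, VanishesToOrder (ν i) (p i) G) :
    ∑ i, μ i * ν i ≤ d * e := by
  choose h hh hhi hhj using fun i => exists_separator hsep i
  choose Θ hΘ using fun i => exists_jets (hp i) (show 4 ≤ d + e + 4 by omega)
  obtain ⟨r, hr⟩ : ∃ r, r = 3 * (Fintype.card ι - 1) + 4 := ⟨_, rfl⟩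
  let ext : ∀ i, ({x : Fin 3 × Fin 3 // (x.1 : ℕ) + x.2 < μ i + ν i - 1} → k) →ₗ[k]
      (Fin 3 × Fin 3 → k) := fun i => Function.ExtendByZero.linearMap k Subtype.val
  let π := LinearMap.proj (R := k)
    (φ := fun i => {x : Fin 3 × Fin 3 // (x.1 : ℕ) + x.2 < μ i + ν i - 1} → k)
  let Ψ : (∀ i, {x : Fin 3 × Fin 3 // (x.1 : ℕ) + x.2 < μ i + ν i - 1} → k) →ₗ[k]
      homogeneousSubmodule (Fin 3) k (d + (e + r)) :=
    ∑ i, mulForm (hh i) (show _ = d + (e + r) by omega) ∘ₗ Θ i ∘ₗ ext i ∘ₗ π i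
  let φ : (homogeneousSubmodule (Fin 3) k (e + r) × homogeneousSubmodule (Fin 3) k (d + r) ×
      (∀ i, {x : Fin 3 × Fin 3 // (x.1 : ℕ) + x.2 < μ i + ν i - 1} → k)) →ₗ[k]
      homogeneousSubmodule (Fin 3) k (d + (e + r)) × ({i // ν i = 2} → k) × ({i // μ i = 2} → k) :=
    LinearMap.prod
      ((mulForm hF rfl).coprod ((mulForm hG (show _ = d + (e + r) by omega)).coprod Ψ))
      (LinearMap.prodMap (evalForms (fun i : {i // ν i = 2} => p i) _)
        (evalForms (fun i : {i // μ i = 2} => p i) _ ∘ₗ LinearMap.fst _ _ _))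
  let ψ : homogeneousSubmodule (Fin 3) k r →ₗ[k] homogeneousSubmodule (Fin 3) k (e + r) ×
      homogeneousSubmodule (Fin 3) k (d + r) ×
      (∀ i, {x : Fin 3 × Fin 3 // (x.1 : ℕ) + x.2 < μ i + ν i - 1} → k) :=
    LinearMap.prod (mulForm hG rfl) (LinearMap.prod (-mulForm hF rfl) 0)
  have hker : LinearMap.ker φ ≤ LinearMap.range ψ := by
    rintro ⟨A, B, c⟩ hx
    have hx' : φ (A, B, c) = 0 := hx
    have hsum : mulForm hF rfl A + (mulForm hG (show _ = d + (e + r) by omega) B + Ψ c) = 0 :=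
      congrArg Prod.fst hx'
    have hA : evalForms (fun i : {i // ν i = 2} => p i) _ A = 0 :=
      congrArg (fun y => y.2.1) hx'
    have hB : evalForms (fun i : {i // μ i = 2} => p i) _ B = 0 :=
      congrArg (fun y => y.2.2) hx'
    have hsum' : F * A + (G * B +
        ∑ i, h i * (Θ i (ext i (c i)) : MvPolynomial (Fin 3) k)) = 0 := by
      have := congrArg Subtype.val hsum
      simpa [Ψ, π] using this
    have hFA : ∀ i, VanishesToOrder (μ i + ν i - 1) (p i) (F * A) := by
      intro i
      have hA' : VanishesToOrder (ν i - 1) (p i) (A : MvPolynomial (Fin 3) k) := by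
        by_cases h2 : ν i = 2
        · rw [h2]
          exact vanishesToOrder_one.2 (by simpa using congrFun hA ⟨i, h2⟩)
        · have := hν i
          rw [show ν i - 1 = 0 by omega]
          exact vanishesToOrder_zero _ _
      exact ((hμF i).mul hA').mono (by omega)
    have hGB : ∀ i, VanishesToOrder (μ i + ν i - 1) (p i) (G * B) := by
      intro i
      have hB' : VanishesToOrder (μ i - 1) (p i) (B : MvPolynomial (Fin 3) k) := by
        by_cases h2 : μ i = 2
        · rw [h2]
          exact vanishesToOrder_one.2 (by simpa using congrFun hB ⟨i, h2⟩)
        · have := hμ i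
          rw [show μ i - 1 = 0 by omega]
          exact vanishesToOrder_zero _ _
      exact ((hνG i).mul hB').mono (by omega)
    have hm : ∀ i, μ i + ν i - 1 ≤ 3 := fun i => by
      have := hμ i
      have := hν i
      omega
    have hc : c = 0 := by
      funext i
      have h1 : VanishesToOrder (μ i + ν i - 1) (p i)
          (h i * (Θ i (ext i (c i)) : MvPolynomial (Fin 3) k)) := by
        have h2 : h i * (Θ i (ext i (c i)) : MvPolynomial (Fin 3) k) = 0 - F * A - G * B -
            ∑ j ∈ Finset.univ.erase i, h j * (Θ j (ext j (c j)) : MvPolynomial (Fin 3) k) := by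
          rw [← Finset.add_sum_erase _ _ (Finset.mem_univ i)] at hsum'
          linear_combination hsum'
        rw [h2]
        refine ((VanishesToOrder.sub (fun v => by simp) (hFA i)).sub (hGB i)).sub
          (VanishesToOrder.sum _ fun j hj => VanishesToOrder.mul_right ?_ _)
        exact (hhj j i (Finset.ne_of_mem_erase hj).symm).mono (hm i)
      have h3 := hΘ i _ (hm i) _ (h1.of_mul (hhi i))
      funext x
      have h4 := h3 x.1 x.2
      simpa [ext, Function.ExtendByZero.linearMap_apply, Subtype.val_injective.extend_apply] using h4
    have hAB : F * (A : MvPolynomial (Fin 3) k) + G * B = 0 := by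
      have hz : ∀ i, Θ i (ext i (c i)) = 0 := fun i => by simp [hc]
      simpa [hz] using hsum'
    obtain ⟨q, hq⟩ : G ∣ (A : MvPolynomial (Fin 3) k) :=
      hFG.symm.dvd_of_dvd_mul_left ⟨-B, by linear_combination hAB⟩
    have hqB : (B : MvPolynomial (Fin 3) k) = -(F * q) := by
      apply mul_left_cancel₀ hG0
      rw [hq] at hAB
      linear_combination hAB
    have hqr : q.IsHomogeneous r := by
      by_cases hA0 : (A : MvPolynomial (Fin 3) k) = 0
      · have : q = 0 := (mul_eq_zero.1 (hq.symm.trans hA0)).resolve_left hG0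
        rw [this]
        exact isHomogeneous_zero _ _ _
      · have hAh : (q * G).IsHomogeneous (e + r) := by
          rw [mul_comm, ← hq]
          exact A.2
        have hqG : q * G ≠ 0 := by rwa [mul_comm, ← hq]
        obtain ⟨i, hi⟩ := exists_isHomogeneous_of_mul hAh hqG
        have := (hi.mul hG).inj_right hAh hqG
        rwa [show r = i by omega]
    refine ⟨⟨q, hqr⟩, ?_⟩
    refine Prod.ext (Subtype.ext ?_) (Prod.ext (Subtype.ext ?_) ?_)
    · simp [ψ, hq]
    · simp [ψ, hqB]
    · simp [ψ, hc]
  have h1 := LinearMap.finrank_range_add_finrank_ker φ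
  have h2 := (LinearMap.range φ).finrank_le
  have h3 := (Submodule.finrank_mono hker).trans (LinearMap.finrank_range_le ψ)
  simp only [Module.finrank_prod, Module.finrank_pi_fintype, Module.finrank_self,
    finrank_homogeneousSubmodule_fin_three] at h1 h2 h3
  have hcard : ∀ a ≤ 2, ∀ b ≤ 2, Fintype.card {x : Fin 3 × Fin 3 // (x.1 : ℕ) + x.2 < a + b - 1} =
      a * b + (if b = 2 then 1 else 0) + (if a = 2 then 1 else 0) := by
    intro a ha b hb
    interval_cases a <;> interval_cases b <;> decide
  have h4 : ∑ i, Fintype.card {x : Fin 3 × Fin 3 // (x.1 : ℕ) + x.2 < μ i + ν i - 1} =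
      ∑ i, μ i * ν i + Fintype.card {i // ν i = 2} + Fintype.card {i // μ i = 2} := by
    rw [Fintype.card_subtype, Fintype.card_subtype, Finset.card_filter, Finset.card_filter,
      ← Finset.sum_add_distrib, ← Finset.sum_add_distrib]
    exact Finset.sum_congr rfl fun i _ => hcard _ (hμ i) _ (hν i)
  have h5 := choose_two_second_difference d e r
  simp only [Finset.sum_const, smul_eq_mul, mul_one, Finset.card_univ] at h1 h2
  omega

end

section

variable {k : Type*} [Field k]

theorem isUnit_of_isHomogeneous_zero {f : MvPolynomial (Fin 3) k} (hf : f.IsHomogeneous 0)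
    (h0 : f ≠ 0) : IsUnit f := by
  have h1 := (totalDegree_zero_iff_isHomogeneous (Fin 3)).2 hf
  rw [totalDegree_eq_zero_iff_eq_C] at h1
  rw [h1] at h0 ⊢
  exact (IsUnit.mk0 _ fun h => h0 (by rw [h, map_zero])).map C

theorem eval_dirDeriv_self {f : MvPolynomial (Fin 3) k} {n : ℕ} (hf : f.IsHomogeneous n)
    (v : Fin 3 → k) : eval v (dirDeriv v f) = n * eval v f := by
  have h := congrArg (eval v) hf.sum_X_mul_pderiv
  simpa [dirDeriv] using h

theorem isHomogeneous_dirDeriv {f : MvPolynomial (Fin 3) k} {n : ℕ} (hf : f.IsHomogeneous n)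
    (v : Fin 3 → k) : (dirDeriv v f).IsHomogeneous (n - 1) :=
  IsHomogeneous.sum _ _ _ fun _ _ => hf.pderiv.C_mul _

theorem dirDeriv_mul (v : Fin 3 → k) (f g : MvPolynomial (Fin 3) k) :
    dirDeriv v (f * g) = f * dirDeriv v g + g * dirDeriv v f := by
  simp only [dirDeriv, Derivation.leibniz, smul_eq_mul, Finset.mul_sum,
    ← Finset.sum_add_distrib]
  exact Finset.sum_congr rfl fun j _ => by ring

theorem isRelPrime_dirDeriv_of_squarefree [CharZero k] {f : MvPolynomial (Fin 3) k} {n : ℕ}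
    (hf : f.IsHomogeneous n) (hsq : Squarefree f) {v : Fin 3 → k} (hv : eval v f ≠ 0) :
    IsRelPrime f (dirDeriv v f) := by
  have hf0 : f ≠ 0 := fun h => hv (by rw [h, map_zero])
  refine WfDvdMonoid.isRelPrime_of_no_irreducible_factors (fun h => hf0 h.1) ?_
  rintro q hq ⟨g, rfl⟩ hd
  obtain ⟨i, hi⟩ := exists_isHomogeneous_of_mul hf hf0
  rw [dirDeriv_mul, dvd_add_right (dvd_mul_right _ _)] at hd
  rw [map_mul] at hv
  rcases hq.prime.dvd_or_dvd hd with ⟨r, rfl⟩ | hd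
  · exact hq.not_isUnit (hsq q ⟨r, by ring⟩)
  · have hi0 : i ≠ 0 := by
      rintro rfl
      exact hq.not_isUnit (isUnit_of_isHomogeneous_zero hi hq.ne_zero)
    have hne : dirDeriv v q ≠ 0 := by
      intro h
      have h2 := eval_dirDeriv_self hi v
      rw [h, map_zero, eq_comm, mul_eq_zero] at h2
      exact h2.elim (by simpa using hi0) (left_ne_zero_of_mul hv)
    obtain ⟨r, hr⟩ := hd
    have h3 := hi.totalDegree hq.ne_zero
    have h4 := (isHomogeneous_dirDeriv hi v).totalDegree hne
    rw [hr] at hne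
    rw [hr, totalDegree_mul_of_isDomain hq.ne_zero (right_ne_zero_of_mul hne)] at h4
    omega

open Classical in
/-- The multiplicity of `f` at `p`, truncated at two. -/
noncomputable def multTwo (p : Fin 3 → k) (f : MvPolynomial (Fin 3) k) : ℕ :=
  if eval p f ≠ 0 then 0 else if VanishesToOrder 2 p f then 2 else 1

variable {p : Fin 3 → k} {f g : MvPolynomial (Fin 3) k}

theorem multTwo_le (p : Fin 3 → k) (f : MvPolynomial (Fin 3) k) : multTwo p f ≤ 2 := by
  unfold multTwo
  split_ifs <;> omega

theorem multTwo_eq_zero : multTwo p f = 0 ↔ eval p f ≠ 0 := by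
  unfold multTwo
  split_ifs <;> simp_all

theorem multTwo_eq_two : multTwo p f = 2 ↔ VanishesToOrder 2 p f := by
  unfold multTwo
  split_ifs with h1 h2
  · simp only [false_iff]
    exact fun h => h1 (vanishesToOrder_one.1 (h.mono one_le_two))
  · simpa using h2
  · simpa using h2

theorem vanishesToOrder_multTwo (p : Fin 3 → k) (f : MvPolynomial (Fin 3) k) :
    VanishesToOrder (multTwo p f) p f := by
  unfold multTwo
  split_ifs with h1 h2
  · exact vanishesToOrder_zero _ _
  · exact h2
  · exact vanishesToOrder_one.2 (not_not.1 h1)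

theorem VanishesToOrder.two_sub_multTwo (h : VanishesToOrder 2 p (f * g)) :
    VanishesToOrder (2 - multTwo p f) p g := by
  unfold multTwo
  split_ifs with h1 h2
  · exact h.of_mul h1
  · exact vanishesToOrder_zero _ _
  · exact vanishesToOrder_one.2 (h.eval_eq_zero_of_mul h2)

section

variable {ι : Type*} [Fintype ι] (p : ι → Fin 3 → k)

/-- The number of points of the family not on the curve `f = 0`. -/
noncomputable def numOff (f : MvPolynomial (Fin 3) k) : ℕ :=
  (Finset.univ.filter fun i => multTwo (p i) f = 0).card

/-- The number of points of the family at which the curve `f = 0` is singular. -/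
noncomputable def numDouble (f : MvPolynomial (Fin 3) k) : ℕ :=
  (Finset.univ.filter fun i => multTwo (p i) f = 2).card

theorem numOff_add_numDouble_le (f : MvPolynomial (Fin 3) k) :
    numOff p f + numDouble p f ≤ Fintype.card ι := by
  classical
  rw [numOff, numDouble, ← Finset.card_union_of_disjoint]
  · exact Finset.card_le_univ _
  · rw [Finset.disjoint_filter]
    intro i _ h
    omega

theorem sum_sq_add_numDouble (f : MvPolynomial (Fin 3) k) :
    ∑ i, (2 - multTwo (p i) f) * (2 - multTwo (p i) f) + numDouble p f =
      Fintype.card ι + 3 * numOff p f := by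
  rw [numOff, numDouble, Finset.card_filter, Finset.card_filter, ← Finset.sum_add_distrib,
    Finset.mul_sum, Fintype.card_eq_sum_ones, ← Finset.sum_add_distrib]
  refine Finset.sum_congr rfl fun i _ => ?_
  have := multTwo_le (p i) f
  generalize multTwo (p i) f = m at *
  interval_cases m <;> rfl

variable {p} {D : MvPolynomial (Fin 3) k} {c : ℕ}

theorem two_mul_numDouble_le [CharZero k] [DecidableEq ι] (hp : ∀ i, p i ≠ 0)
    (hsep : Separated p) (hD : D.IsHomogeneous c) (hc : c ≠ 0) (hsq : Squarefree D) :
    2 * numDouble p D ≤ c * (c - 1) := by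
  have hD0 : D ≠ 0 := hsq.ne_zero
  obtain ⟨v, hv⟩ : ∃ v, eval v D ≠ 0 := by
    by_contra! h
    exact hD0 (MvPolynomial.funext fun v => by simpa using h v)
  have hne : dirDeriv v D ≠ 0 := by
    intro h
    have h2 := eval_dirDeriv_self hD v
    rw [h, map_zero, eq_comm, mul_eq_zero] at h2
    exact h2.elim (by simpa using hc) hv
  have h := sum_mul_le_of_isRelPrime hp hsep hD (isHomogeneous_dirDeriv hD v) hne
    (isRelPrime_dirDeriv_of_squarefree hD hsq hv)
    (μ := fun i => multTwo (p i) D) (ν := fun i => if multTwo (p i) D = 2 then 1 else 0)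
    (fun i => multTwo_le _ _) (fun i => by split_ifs <;> omega)
    (fun i => vanishesToOrder_multTwo _ _) (fun i => by
      split_ifs with h
      · exact (multTwo_eq_two.1 h).dirDeriv v
      · exact vanishesToOrder_zero _ _)
  refine le_trans (le_of_eq ?_) h
  rw [numDouble, Finset.card_filter, Finset.mul_sum]
  refine Finset.sum_congr rfl fun i _ => ?_
  split_ifs with h <;> simp [h]

theorem choose_le_numOff (hcub : ∀ f : MvPolynomial (Fin 3) k, f.IsHomogeneous 3 →
    (∀ i, eval (p i) f = 0) → f = 0) (hD : D.IsHomogeneous c) (hD0 : D ≠ 0) (hc : c ≤ 3) :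
    (3 - c + 2).choose 2 ≤ numOff p D := by
  by_contra! hlt
  have hcard : numOff p D = Fintype.card {i // multTwo (p i) D = 0} := by
    rw [numOff, Fintype.card_subtype]
  have hker : LinearMap.ker (evalForms (fun i : {i // multTwo (p i) D = 0} => p i) (3 - c)) ≠ ⊥ := by
    apply LinearMap.ker_ne_bot_of_finrank_lt
    rw [finrank_homogeneousSubmodule_fin_three, Module.finrank_fintype_fun_eq_card, ← hcard]
    exact hlt
  obtain ⟨g, hg, hg0⟩ := Submodule.exists_mem_ne_zero_of_ne_bot hker
  have h3 : (D * g).IsHomogeneous 3 := by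
    have := hD.mul g.2
    rwa [Nat.add_sub_cancel' hc] at this
  have hDg := hcub _ h3 fun i => by
    rw [map_mul]
    by_cases h : multTwo (p i) D = 0
    · rw [show eval (p i) (g : MvPolynomial (Fin 3) k) = 0 by simpa using congrFun hg ⟨i, h⟩,
        mul_zero]
    · rw [multTwo_eq_zero, not_not] at h
      rw [h, zero_mul]
  exact (mul_ne_zero hD0 fun h => hg0 (Subtype.ext h)) hDg

theorem numOff_sq_mul (A B : MvPolynomial (Fin 3) k) :
    numOff p (A * A * B) = numOff p (A * B) := by
  simp only [numOff]
  congr 1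
  ext i
  simp [multTwo_eq_zero]

theorem numDouble_sq_mul_le (A B : MvPolynomial (Fin 3) k) :
    numDouble p (A * A * B) + numOff p A ≤ Fintype.card ι + numDouble p B := by
  classical
  rw [numDouble, numOff, numDouble, Finset.card_filter, Finset.card_filter, Finset.card_filter,
    Fintype.card_eq_sum_ones, ← Finset.sum_add_distrib, ← Finset.sum_add_distrib]
  refine Finset.sum_le_sum fun i _ => ?_
  by_cases hA : multTwo (p i) A = 0
  · by_cases hD : multTwo (p i) (A * A * B) = 2
    · have hB : multTwo (p i) B = 2 := by
        rw [multTwo_eq_two] at hD ⊢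
        rw [multTwo_eq_zero] at hA
        exact hD.of_mul (by simpa using hA)
      simp [hA, hD, hB]
    · simp [hA, hD]
  · simp only [hA, if_false]
    split_ifs <;> omega

theorem exists_sq_mul_of_not_squarefree (hD : D.IsHomogeneous c) (hD0 : D ≠ 0)
    (hsq : ¬ Squarefree D) : ∃ (A B : MvPolynomial (Fin 3) k) (a b : ℕ), A.IsHomogeneous a ∧
      B.IsHomogeneous b ∧ A ≠ 0 ∧ B ≠ 0 ∧ 1 ≤ a ∧ 2 * a + b = c ∧ D = A * A * B := by
  rw [Squarefree] at hsq
  push Not at hsq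
  obtain ⟨A, ⟨B, rfl⟩, hA⟩ := hsq
  have hB0 := right_ne_zero_of_mul hD0
  have hA0 := left_ne_zero_of_mul (left_ne_zero_of_mul hD0)
  obtain ⟨b, hb⟩ := exists_isHomogeneous_of_mul (by rwa [mul_comm] at hD) (by rwa [mul_comm] at hD0)
  obtain ⟨a, ha⟩ := exists_isHomogeneous_of_mul (by rwa [mul_assoc] at hD) (by rwa [mul_assoc] at hD0)
  refine ⟨A, B, a, b, ha, hb, hA0, hB0, ?_, ?_, rfl⟩
  · rw [Nat.one_le_iff_ne_zero]
    rintro rfl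
    exact hA (isUnit_of_isHomogeneous_zero ha hA0)
  · have := ((ha.mul ha).mul hb).inj_right hD hD0
    omega

/-- Position of a curve of degree at most four with respect to points lying on no cubic. -/
theorem numOff_numDouble_cases [CharZero k] [DecidableEq ι] (hι : Fintype.card ι = 11)
    (hp : ∀ i, p i ≠ 0) (hsep : Separated p)
    (hcub : ∀ f : MvPolynomial (Fin 3) k, f.IsHomogeneous 3 → (∀ i, eval (p i) f = 0) → f = 0)
    (hD : D.IsHomogeneous c) (hD0 : D ≠ 0) :
    (c = 0 → numOff p D = 11) ∧ (c = 1 → 6 ≤ numOff p D ∧ numDouble p D = 0) ∧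
    (c = 2 → 3 ≤ numOff p D ∧ (numDouble p D ≤ 1 ∨ 6 ≤ numOff p D)) ∧
    (c = 3 → 1 ≤ numOff p D ∧ (numDouble p D ≤ 3 ∨ 3 ≤ numOff p D)) ∧
    (c = 4 → numDouble p D ≤ 6 ∨ 3 ≤ numOff p D) := by
  have hoff : ∀ {A : MvPolynomial (Fin 3) k} {a : ℕ}, A.IsHomogeneous a → A ≠ 0 → a ≤ 3 →
    (3 - a + 2).choose 2 ≤ numOff p A := fun hA hA0 ha => choose_le_numOff hcub hA hA0 ha
  refine ⟨?_, ?_, ?_, ?_, ?_⟩ <;> rintro rfl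
  · have hu := isUnit_of_isHomogeneous_zero hD hD0
    have : ∀ i, multTwo (p i) D = 0 := fun i => multTwo_eq_zero.2 (hu.map (eval (p i))).ne_zero
    simp [numOff, this, hι]
  · have h1 := hoff hD hD0 (by norm_num)
    norm_num [Nat.choose] at h1
    by_cases hsq : Squarefree D
    · have := two_mul_numDouble_le hp hsep hD (by norm_num) hsq
      omega
    · obtain ⟨A, B, a, b, ha, hb, hA0, hB0, ha1, hab, rfl⟩ :=
        exists_sq_mul_of_not_squarefree hD hD0 hsq
      omega
  · have h1 := hoff hD hD0 (by norm_num)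
    norm_num [Nat.choose] at h1
    by_cases hsq : Squarefree D
    · have := two_mul_numDouble_le hp hsep hD (by norm_num) hsq
      omega
    · obtain ⟨A, B, a, b, ha, hb, hA0, hB0, ha1, hab, rfl⟩ :=
        exists_sq_mul_of_not_squarefree hD hD0 hsq
      obtain ⟨rfl, rfl⟩ : a = 1 ∧ b = 0 := by omega
      have h2 := hoff (ha.mul hb) (mul_ne_zero hA0 hB0) (by norm_num)
      norm_num [Nat.choose] at h2
      rw [numOff_sq_mul] at *
      exact ⟨h1, Or.inr h2⟩
  · have h1 := hoff hD hD0 (by norm_num)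
    norm_num [Nat.choose] at h1
    by_cases hsq : Squarefree D
    · have := two_mul_numDouble_le hp hsep hD (by norm_num) hsq
      omega
    · obtain ⟨A, B, a, b, ha, hb, hA0, hB0, ha1, hab, rfl⟩ :=
        exists_sq_mul_of_not_squarefree hD hD0 hsq
      obtain ⟨rfl, rfl⟩ : a = 1 ∧ b = 1 := by omega
      have h2 := hoff (ha.mul hb) (mul_ne_zero hA0 hB0) (by norm_num)
      norm_num [Nat.choose] at h2
      rw [numOff_sq_mul] at *
      omega
  · by_cases hsq : Squarefree D
    · have := two_mul_numDouble_le hp hsep hD (by norm_num) hsq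
      omega
    · obtain ⟨A, B, a, b, ha, hb, hA0, hB0, ha1, hab, rfl⟩ :=
        exists_sq_mul_of_not_squarefree hD hD0 hsq
      have hab' : (a = 1 ∧ b = 2) ∨ (a = 2 ∧ b = 0) := by omega
      rcases hab' with ⟨rfl, rfl⟩ | ⟨rfl, rfl⟩
      · by_cases hsqB : Squarefree B
        · have h2 := two_mul_numDouble_le hp hsep hb (by norm_num) hsqB
          have h3 := hoff ha hA0 (by norm_num)
          norm_num [Nat.choose] at h3
          have h4 := numDouble_sq_mul_le (p := p) A B
          omega
        · obtain ⟨A', B', a', b', ha', hb', hA0', hB0', ha1', hab', rfl⟩ :=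
            exists_sq_mul_of_not_squarefree hb hB0 hsqB
          obtain ⟨rfl, rfl⟩ : a' = 1 ∧ b' = 0 := by omega
          have h2 := hoff ((ha.mul ha').mul hb')
            (mul_ne_zero (mul_ne_zero hA0 hA0') hB0') (by norm_num)
          norm_num [Nat.choose] at h2
          rw [← numOff_sq_mul, show A * A' * (A * A') * B' = A * A * (A' * A' * B') by ring] at h2
          exact Or.inr h2
      · have h2 := hoff (ha.mul hb) (mul_ne_zero hA0 hB0) (by norm_num)
        norm_num [Nat.choose] at h2
        rw [numOff_sq_mul] at *
        exact Or.inr h2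

end

end

section

variable {k : Type*} [Field k]

theorem exists_homogeneous_reduced_factors {F G : MvPolynomial (Fin 3) k} {d e : ℕ}
    (hF : F.IsHomogeneous d) (hG : G.IsHomogeneous e) (hF0 : F ≠ 0) (hG0 : G ≠ 0) :
    ∃ (D F' G' : MvPolynomial (Fin 3) k) (c a b : ℕ), D.IsHomogeneous c ∧ F'.IsHomogeneous a ∧
      G'.IsHomogeneous b ∧ D ≠ 0 ∧ F' ≠ 0 ∧ G' ≠ 0 ∧ c + a = d ∧ c + b = e ∧
      IsRelPrime F' G' ∧ F = D * F' ∧ G = D * G' := by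
  obtain ⟨F', G', D, hrel, rfl, rfl⟩ :=
    UniqueFactorizationMonoid.exists_reduced_factors F hF0 G
  obtain ⟨c, hc⟩ := exists_isHomogeneous_of_mul hF hF0
  obtain ⟨a, ha⟩ := exists_isHomogeneous_of_mul (mul_comm D F' ▸ hF) (mul_comm D F' ▸ hF0)
  obtain ⟨b, hb⟩ := exists_isHomogeneous_of_mul (mul_comm D G' ▸ hG) (mul_comm D G' ▸ hG0)
  exact ⟨D, F', G', c, a, b, hc, ha, hb, left_ne_zero_of_mul hF0, right_ne_zero_of_mul hF0,
    right_ne_zero_of_mul hG0, (hc.mul ha).inj_right hF hF0, (hc.mul hb).inj_right hG hG0,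
    hrel, rfl, rfl⟩

theorem exists_C_mul_eq_of_isHomogeneous_zero {f g : MvPolynomial (Fin 3) k}
    (hf : f.IsHomogeneous 0) (hg : g.IsHomogeneous 0) (hf0 : f ≠ 0) : ∃ a, g = C a * f := by
  have hf1 := (totalDegree_zero_iff_isHomogeneous (Fin 3)).2 hf
  have hg1 := (totalDegree_zero_iff_isHomogeneous (Fin 3)).2 hg
  rw [totalDegree_eq_zero_iff_eq_C] at hf1 hg1
  have h : coeff 0 f ≠ 0 := fun h => hf0 (by rw [hf1, h, map_zero])
  refine ⟨coeff 0 g / coeff 0 f, ?_⟩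
  calc g = C (coeff 0 g / coeff 0 f * coeff 0 f) := by rw [div_mul_cancel₀ _ h, ← hg1]
    _ = C (coeff 0 g / coeff 0 f) * f := by rw [map_mul, ← hf1]

variable [CharZero k] {ι : Type*} [Fintype ι] [DecidableEq ι] {p : ι → Fin 3 → k}

/-- Two independent sextics singular at eleven points lying on no cubic share a quintic. -/
theorem exists_common_quintic (hι : Fintype.card ι = 11) (hp : ∀ i, p i ≠ 0) (hsep : Separated p)
    (hcub : ∀ f : MvPolynomial (Fin 3) k, f.IsHomogeneous 3 → (∀ i, eval (p i) f = 0) → f = 0)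
    {F G : MvPolynomial (Fin 3) k} (hF : F.IsHomogeneous 6) (hG : G.IsHomogeneous 6)
    (hF0 : F ≠ 0) (hG0 : G ≠ 0) (hFG : ∀ a, G ≠ C a * F)
    (hF2 : ∀ i, VanishesToOrder 2 (p i) F) (hG2 : ∀ i, VanishesToOrder 2 (p i) G) :
    ∃ D L M : MvPolynomial (Fin 3) k, D.IsHomogeneous 5 ∧ L.IsHomogeneous 1 ∧ M.IsHomogeneous 1 ∧
      D ≠ 0 ∧ L ≠ 0 ∧ M ≠ 0 ∧ IsRelPrime L M ∧ F = D * L ∧ G = D * M := by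
  obtain ⟨D, L, M, c, a, b, hD, hL, hM, hD0, hL0, hM0, hca, hcb, hrel, rfl, rfl⟩ :=
    exists_homogeneous_reduced_factors hF hG hF0 hG0
  obtain rfl : a = b := by omega
  have hbez := sum_mul_le_of_isRelPrime hp hsep hL hM hM0 hrel
    (μ := fun i => 2 - multTwo (p i) D) (ν := fun i => 2 - multTwo (p i) D)
    (fun i => Nat.sub_le _ _) (fun i => Nat.sub_le _ _)
    (fun i => (hF2 i).two_sub_multTwo) (fun i => (hG2 i).two_sub_multTwo)
  have hsum := sum_sq_add_numDouble p D
  have hle := numOff_add_numDouble_le p D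
  obtain ⟨h0, h1, h2, h3, h4⟩ := numOff_numDouble_cases hι hp hsep hcub hD hD0
  have hc : c ≤ 6 := by omega
  obtain rfl : a = 6 - c := by omega
  by_cases hc5 : c = 5
  · subst hc5
    exact ⟨D, L, M, hD, hL, hM, hD0, hL0, hM0, hrel, rfl, rfl⟩
  by_cases hc6 : c = 6
  · subst hc6
    obtain ⟨s, hs⟩ := exists_C_mul_eq_of_isHomogeneous_zero hL hM hL0
    exact (hFG s (by rw [hs]; ring)).elim
  · have hc4 : c ≤ 4 := by omega
    interval_cases c <;> norm_num at hbez h0 h1 h2 h3 h4 <;> omega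

/-- A septic singular at eleven points lying on no cubic contains every quintic passing through
one of the points and singular at the others. -/
theorem quintic_dvd_septic (hι : Fintype.card ι = 11) (hp : ∀ i, p i ≠ 0) (hsep : Separated p)
    (hcub : ∀ f : MvPolynomial (Fin 3) k, f.IsHomogeneous 3 → (∀ i, eval (p i) f = 0) → f = 0)
    {F T : MvPolynomial (Fin 3) k} (hF : F.IsHomogeneous 5) (hT : T.IsHomogeneous 7)
    (hF0 : F ≠ 0) {o : ι} (ho : eval (p o) F = 0) (ho2 : ¬ VanishesToOrder 2 (p o) F)
    (hF2 : ∀ i, i ≠ o → VanishesToOrder 2 (p i) F) (hT2 : ∀ i, VanishesToOrder 2 (p i) T) :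
    F ∣ T := by
  by_cases hT0 : T = 0
  · exact hT0 ▸ dvd_zero F
  obtain ⟨D, F', T', c, a, b, hD, hF', hT', hD0, hF0', hT0', hca, hcb, hrel, rfl, rfl⟩ :=
    exists_homogeneous_reduced_factors hF hT hF0 hT0
  have hmo : multTwo (p o) D ≠ 2 := fun h => ho2 ((multTwo_eq_two.1 h).mul_right _)
  have hbez := sum_mul_le_of_isRelPrime hp hsep hF' hT' hT0' hrel
    (μ := fun i => if i = o then 1 - multTwo (p i) D else 2 - multTwo (p i) D)
    (ν := fun i => 2 - multTwo (p i) D)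
    (fun i => by split_ifs <;> omega) (fun i => Nat.sub_le _ _)
    (fun i => by
      split_ifs with h
      · subst h
        by_cases hm : multTwo (p i) D = 0
        · rw [hm]
          exact (vanishesToOrder_one.2 ho).of_mul (multTwo_eq_zero.1 hm)
        · rw [show 1 - multTwo (p i) D = 0 by omega]
          exact vanishesToOrder_zero _ _
      · exact (hF2 i h).two_sub_multTwo)
    (fun i => (hT2 i).two_sub_multTwo)
  have hsum := sum_sq_add_numDouble p D
  have hle := numOff_add_numDouble_le p D
  have hoff : multTwo (p o) D = 0 → 0 < numOff p D := fun h =>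
    Finset.card_pos.2 ⟨o, by simpa using h⟩
  have hdiff : ∑ i, (if i = o then 1 - multTwo (p i) D else 2 - multTwo (p i) D) *
      (2 - multTwo (p i) D) + (2 - multTwo (p o) D) =
      ∑ i, (2 - multTwo (p i) D) * (2 - multTwo (p i) D) := by
    rw [← Finset.add_sum_erase _ _ (Finset.mem_univ o),
      ← Finset.add_sum_erase _ (fun i => (2 - multTwo (p i) D) * (2 - multTwo (p i) D))
        (Finset.mem_univ o),
      Finset.sum_congr rfl fun i hi => by rw [if_neg (Finset.ne_of_mem_erase hi)], if_pos rfl]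
    have := multTwo_le (p o) D
    generalize multTwo (p o) D = m at *
    interval_cases m <;> omega
  replace hbez := Nat.add_le_add_right hbez (2 - multTwo (p o) D)
  rw [hdiff] at hbez
  have hmle := multTwo_le (p o) D
  obtain ⟨h0, h1, h2, h3, h4⟩ := numOff_numDouble_cases hι hp hsep hcub hD hD0
  have hc : c ≤ 5 := by omega
  obtain rfl : a = 5 - c := by omega
  obtain rfl : b = 7 - c := by omega
  by_cases hc5 : c = 5
  · subst hc5
    exact mul_dvd_mul_left _ (isUnit_of_isHomogeneous_zero hF' hF0').dvd
  · have hc4 : c ≤ 4 := by omega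
    interval_cases c <;> norm_num at hbez h0 h1 h2 h3 h4 <;> omega

end

section

variable {k : Type} [Field k] {P : Projectivization k (Fin 3 → k)} {f : MvPolynomial (Fin 3) k}
  {n : ℕ}

theorem exists_taylor_pointIdeal (P : Projectivization k (Fin 3 → k)) :
    ∃ (t : MvPolynomial (Fin 3) k) (u : Fin 3 → MvPolynomial (Fin 3) k),
      (∀ j, u j ∈ pointIdeal k P) ∧ ∀ (f : MvPolynomial (Fin 3) k) (n : ℕ), f.IsHomogeneous n →
        f - (C (eval P.rep f) * t ^ n + ∑ j, u j * (C (eval P.rep (pderiv j f)) * t ^ (n - 1))) ∈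
          pointIdeal k P ^ 2 := by
  obtain ⟨c, hc⟩ := Function.ne_iff.1 P.rep_nonzero
  simp only [Pi.zero_apply] at hc
  let t : MvPolynomial (Fin 3) k := C (P.rep c)⁻¹ * X c
  let u : Fin 3 → MvPolynomial (Fin 3) k := fun j => X j - C (P.rep j) * t
  have hu : ∀ j, u j ∈ pointIdeal k P := fun j => Ideal.subset_span
    ⟨(isHomogeneous_X k j).sub ((isHomogeneous_C_mul_X _ c).C_mul _), by simp [u, t, hc]⟩
  have hC (q : MvPolynomial (Fin 3) k) :
      aeval (fun j => (C (P.rep j) : MvPolynomial (Fin 3) k)) q = C (eval P.rep q) :=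
    aeval_algebraMap_apply _ P.rep q
  refine ⟨t, u, hu, fun f n hf => ?_⟩
  have h := aeval_add_sub_taylor_mem (pointIdeal k P) (fun j => C (P.rep j) * t) u hu f
  simp only [u, add_sub_cancel, aeval_X_left_apply] at h
  rw [aeval_mul_const_of_isHomogeneous hf, hC] at h
  simpa only [aeval_mul_const_of_isHomogeneous hf.pderiv, hC] using h

theorem mem_pointIdeal_of_eval_eq_zero (hf : f.IsHomogeneous n) (h : eval P.rep f = 0) :
    f ∈ pointIdeal k P := by
  obtain ⟨t, u, hu, H⟩ := exists_taylor_pointIdeal P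
  have h1 := Ideal.pow_le_self two_ne_zero (H f n hf)
  rw [h, map_zero, zero_mul, zero_add] at h1
  exact (Submodule.sub_mem_iff_left _
    (Ideal.sum_mem _ fun j _ => Ideal.mul_mem_right _ _ (hu j))).1 h1

theorem mem_pointIdeal_sq (hf : f.IsHomogeneous n) :
    f ∈ pointIdeal k P ^ 2 ↔ VanishesToOrder 2 P.rep f := by
  constructor
  · intro h v
    have hle : pointIdeal k P ≤
        (Ideal.span {(Polynomial.X : Polynomial k)}).comap (restrictLine P.rep v) := by
      refine Ideal.span_le.2 fun q hq => ?_
      rw [SetLike.mem_coe, Ideal.mem_comap, Ideal.mem_span_singleton]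
      simpa using vanishesToOrder_one.2 hq.2 v
    have h2 := Ideal.le_comap_pow _ 2 (Ideal.pow_right_mono hle 2 h)
    rwa [Ideal.mem_comap, Ideal.span_singleton_pow, Ideal.mem_span_singleton] at h2
  · intro h
    obtain ⟨t, u, hu, H⟩ := exists_taylor_pointIdeal P
    rw [vanishesToOrder_two] at h
    simpa [h.1, h.2] using H f n hf

theorem separated_rep {ι : Type*} {P : ι → Projectivization k (Fin 3 → k)}
    (hP : Function.Injective P) : Separated fun i => (P i).rep := by
  intro i j hij
  have hnot : (P i).rep ∉ Submodule.span k {(P j).rep} := by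
    rw [Submodule.mem_span_singleton, ← Projectivization.mk_eq_mk_iff' k _ _ (P i).rep_nonzero
      (P j).rep_nonzero, Projectivization.mk_rep, Projectivization.mk_rep]
    exact hP.ne hij
  obtain ⟨φ, hi, hj⟩ := Submodule.exists_le_ker_of_notMem hnot
  have heval (q : Fin 3 → k) : eval q (linForm fun a => φ fun j => if a = j then 1 else 0) = φ q := by
    rw [eval_linForm, φ.pi_apply_eq_sum_univ q]
    exact Finset.sum_congr rfl fun a _ => by rw [smul_eq_mul, mul_comm]
  refine ⟨fun a => φ fun j => if a = j then 1 else 0, ?_, ?_⟩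
  · rw [heval]
    exact hj (Submodule.mem_span_singleton_self _)
  · rwa [heval]

end

/-- For 11 points of ℙ² with generic Hilbert function, if H_{2X}(6) = 26 then
H_{2X}(7) ≥ 31. -/
theorem statement6 (k : Type) [Field k] [IsAlgClosed k] [CharZero k]
    (P : Fin 11 → Projectivization k (Fin 3 → k)) (hinj : Function.Injective P)
    (hgen : HasGenericHilbertFunction k P)
    (h6 : hilbertFunction k (doubleIdealOfPoints k P) 6 = 26) :
    31 ≤ hilbertFunction k (doubleIdealOfPoints k P) 7 := by
  have hp : ∀ i, (P i).rep ≠ 0 := fun i => (P i).rep_nonzero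
  have hsep := separated_rep hinj
  have mem_double : ∀ {n : ℕ} {f : MvPolynomial (Fin 3) k}, f.IsHomogeneous n →
      (f ∈ doubleIdealOfPoints k P ↔ ∀ i, VanishesToOrder 2 (P i).rep f) := by
    intro n f hf
    simp only [doubleIdealOfPoints, Submodule.mem_iInf, mem_pointIdeal_sq hf]
  have hcub : ∀ f : MvPolynomial (Fin 3) k, f.IsHomogeneous 3 →
      (∀ i, eval (P i).rep f = 0) → f = 0 := by
    intro f hf h
    have h3 := hgen 3
    rw [hilbertFunction, finrank_homogeneousSubmodule_fin_three] at h3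
    have h4 : Module.finrank k ↥(Submodule.restrictScalars k (idealOfPoints k P) ⊓
      homogeneousSubmodule (Fin 3) k 3) = 0 := by
      norm_num [Nat.choose] at h3
      omega
    rw [Submodule.finrank_eq_zero] at h4
    have h5 : f ∈ Submodule.restrictScalars k (idealOfPoints k P) ⊓
        homogeneousSubmodule (Fin 3) k 3 :=
      ⟨by simpa [idealOfPoints, Submodule.mem_iInf] using
        fun i => mem_pointIdeal_of_eval_eq_zero hf (h i), hf⟩
    rwa [h4, Submodule.mem_bot] at h5
  have hV : Module.finrank k ↥(Submodule.restrictScalars k (doubleIdealOfPoints k P) ⊓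
      homogeneousSubmodule (Fin 3) k 6) = 2 := by
    have h7 := h6
    rw [hilbertFunction, finrank_homogeneousSubmodule_fin_three] at h7
    norm_num [Nat.choose] at h7
    omega
  obtain ⟨F, G, hF, hG, hF0, hFG, hF2, hG2⟩ : ∃ F G : MvPolynomial (Fin 3) k, F.IsHomogeneous 6 ∧
      G.IsHomogeneous 6 ∧ F ≠ 0 ∧ (∀ a, G ≠ C a * F) ∧
      (∀ i, VanishesToOrder 2 (P i).rep F) ∧ ∀ i, VanishesToOrder 2 (P i).rep G := by
    let b := Module.finBasisOfFinrankEq k _ hV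
    have hne := b.ne_zero 0
    refine ⟨b 0, b 1, (b 0).2.2, (b 1).2.2, fun h => hne (Subtype.ext h), fun a h => ?_,
      (mem_double (b 0).2.2).1 (b 0).2.1, (mem_double (b 1).2.2).1 (b 1).2.1⟩
    have h1 : b 1 = a • b 0 := Subtype.ext (by rw [h, ← smul_eq_C_mul]; rfl)
    simpa using congrArg (fun x => b.repr x 1) h1
  have hG0 : G ≠ 0 := fun h => hFG 0 (by rw [h, map_zero, zero_mul])
  obtain ⟨D, L, M, hD, hL, hM, hD0, hL0, hM0, hrel, rfl, rfl⟩ :=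
    exists_common_quintic (by simp) hp hsep hcub hF hG hF0 hG0 hFG hF2 hG2
  have hinjD : Function.Injective (LinearMap.mulLeft k D) :=
    fun _ _ h => mul_left_cancel₀ hD0 h
  obtain ⟨o, ho⟩ : ∃ o, ¬ VanishesToOrder 2 (P o).rep D := by
    by_contra! hall
    have hle : (homogeneousSubmodule (Fin 3) k 1).map (LinearMap.mulLeft k D) ≤
        Submodule.restrictScalars k (doubleIdealOfPoints k P) ⊓
          homogeneousSubmodule (Fin 3) k 6 := by
      rintro _ ⟨g, hg, rfl⟩
      have hDg : (D * g).IsHomogeneous 6 := hD.mul hg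
      exact ⟨(mem_double hDg).2 fun i => (hall i).mul_right g, hDg⟩
    have h := Submodule.finrank_mono hle
    rw [hV, ← (Submodule.equivMapOfInjective _ hinjD _).finrank_eq,
      finrank_homogeneousSubmodule_fin_three] at h
    norm_num [Nat.choose] at h
  have hLo := (hF2 o).eval_eq_zero_of_mul ho
  have hMo := (hG2 o).eval_eq_zero_of_mul ho
  have hD2 : ∀ i, i ≠ o → VanishesToOrder 2 (P i).rep D := by
    intro i hi
    by_contra hDi
    have h := sum_mul_le_of_isRelPrime hp hsep hL hM hM0 hrel
      (μ := fun j => if j = o ∨ j = i then 1 else 0) (ν := fun j => if j = o ∨ j = i then 1 else 0)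
      (fun j => by split_ifs <;> omega) (fun j => by split_ifs <;> omega)
      (fun j => by
        split_ifs with h
        · rcases h with rfl | rfl
          exacts [vanishesToOrder_one.2 hLo,
            vanishesToOrder_one.2 ((hF2 j).eval_eq_zero_of_mul hDi)]
        · exact vanishesToOrder_zero _ _)
      (fun j => by
        split_ifs with h
        · rcases h with rfl | rfl
          exacts [vanishesToOrder_one.2 hMo,
            vanishesToOrder_one.2 ((hG2 j).eval_eq_zero_of_mul hDi)]
        · exact vanishesToOrder_zero _ _)
    have h2 := (Finset.sum_le_sum_of_subset (Finset.subset_univ {o, i})).trans h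
    rw [Finset.sum_pair hi.symm] at h2
    simp at h2
  have hDo : eval (P o).rep D = 0 := by
    by_contra hDo
    have h := sum_mul_le_of_isRelPrime hp hsep hL hM hM0 hrel
      (μ := fun j => if j = o then 2 else 0) (ν := fun j => if j = o then 1 else 0)
      (fun j => by split_ifs <;> omega) (fun j => by split_ifs <;> omega)
      (fun j => by
        split_ifs with h
        · exact h ▸ (hF2 o).of_mul hDo
        · exact vanishesToOrder_zero _ _)
      (fun j => by
        split_ifs with h
        · exact h ▸ vanishesToOrder_one.2 hMo
        · exact vanishesToOrder_zero _ _)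
    simp at h
  let K : Submodule k (MvPolynomial (Fin 3) k) :=
    homogeneousSubmodule (Fin 3) k 2 ⊓ LinearMap.ker (aeval (P o).rep).toLinearMap
  have hK : Module.finrank k K < 6 := by
    have hlt : K < homogeneousSubmodule (Fin 3) k 2 := by
      refine lt_of_le_of_ne inf_le_left fun h => ?_
      obtain ⟨c, hc⟩ := Function.ne_iff.1 (hp o)
      have hX : (X c ^ 2 : MvPolynomial (Fin 3) k) ∈ K := h ▸ isHomogeneous_X_pow c 2
      exact hc (by simpa [K] using hX.2)
    have h := Submodule.finrank_lt_finrank_of_lt hlt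
    rwa [finrank_homogeneousSubmodule_fin_three] at h
  have hle : Submodule.restrictScalars k (doubleIdealOfPoints k P) ⊓
      homogeneousSubmodule (Fin 3) k 7 ≤ K.map (LinearMap.mulLeft k D) := by
    rintro T ⟨hTI, hT⟩
    replace hTI := (mem_double hT).1 hTI
    obtain ⟨Q, rfl⟩ := quintic_dvd_septic (by simp) hp hsep hcub hD hT hD0 hDo ho hD2 hTI
    refine ⟨Q, ⟨?_, ?_⟩, rfl⟩
    · by_cases hQ : Q = 0
      · exact hQ ▸ zero_mem _
      · have hDQ := mul_ne_zero hD0 hQ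
        obtain ⟨i, hi⟩ := exists_isHomogeneous_of_mul (mul_comm D Q ▸ hT) (mul_comm D Q ▸ hDQ)
        have := (hD.mul hi).inj_right hT hDQ
        obtain rfl : i = 2 := by omega
        exact hi
    · simpa [aeval_eq_eval] using (hTI o).eval_eq_zero_of_mul ho
  have h := (Submodule.finrank_mono hle).trans (Submodule.finrank_map_le _ _)
  rw [hilbertFunction, finrank_homogeneousSubmodule_fin_three]
  norm_num [Nat.choose]
  omega
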